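/- Let P_k be a probability distribution on 𝒳^k. Then the sum of interaction information terms of order 2 and higher equals the total correlation: Σ_{r=2}^k I^{(r)}(P_k) = C(P_k). -/

import Mathlib

/-!
STATEMENT 2: The sum of interaction information terms of order 2 and higher equals the
total correlation: `Σ_{r=2}^k I^{(r)}(P) = C(P)`, where `C(P) = Σ_i H(X_{{i}}) − H(X_{[k]})`.
-/

noncomputable section

open Finset

/-- Shannon entropy (base 2); `0 * log₂ 0 = 0` holds since `Real.logb 2 0 = 0`. -/
def entropy {A : Type*} [Fintype A] (p : A → ℝ) : ℝ :=
  -∑ a, p a * Real.logb 2 (p a)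

/-- The marginal of `P` on the coordinates in `S ⊆ {1,…,k}`, a distribution on `𝒳^S`. -/
def margS {𝒳 : Type*} [Fintype 𝒳] [DecidableEq 𝒳] {k : ℕ}
    (P : (Fin k → 𝒳) → ℝ) (S : Finset (Fin k)) : ((i : S) → 𝒳) → ℝ :=
  fun z => ∑ y : Fin k → 𝒳, if ∀ i : S, y i = z i then P y else 0

/-- `H(X_S)`: Shannon entropy of the marginal on `S`. -/
def HS {𝒳 : Type*} [Fintype 𝒳] [DecidableEq 𝒳] {k : ℕ}
    (P : (Fin k → 𝒳) → ℝ) (S : Finset (Fin k)) : ℝ :=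
  entropy (margS P S)

/-- Interaction information `I(S) = −Σ_{T ⊆ S} (−1)^{|S|−|T|} H(X_T)`. -/
def II {𝒳 : Type*} [Fintype 𝒳] [DecidableEq 𝒳] {k : ℕ}
    (P : (Fin k → 𝒳) → ℝ) (S : Finset (Fin k)) : ℝ :=
  -∑ T ∈ S.powerset, (-1 : ℝ) ^ (S.card - T.card) * HS P T

/-- Total `r`-way interaction information `I^{(r)}(P) = Σ_{|S| = r} I(S)`. -/
def Ir {𝒳 : Type*} [Fintype 𝒳] [DecidableEq 𝒳] {k : ℕ}
    (P : (Fin k → 𝒳) → ℝ) (r : ℕ) : ℝ :=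
  ∑ S ∈ Finset.powersetCard r (Finset.univ : Finset (Fin k)), II P S

/-- Möbius inversion on the Boolean lattice of subsets of `U`. -/
theorem sum_powerset_sum_powerset_neg_one_pow {α : Type*} [DecidableEq α]
    (U : Finset α) (h : Finset α → ℝ) :
    ∑ S ∈ U.powerset, ∑ T ∈ S.powerset, (-1 : ℝ) ^ (S.card - T.card) * h T = h U := by
  have hswap : ∑ S ∈ U.powerset, ∑ T ∈ S.powerset, (-1 : ℝ) ^ (S.card - T.card) * h T =
      ∑ T ∈ U.powerset, ∑ S ∈ Finset.Icc T U, (-1 : ℝ) ^ (S.card - T.card) * h T := by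
    refine Finset.sum_comm' fun S T => ?_
    simp only [Finset.mem_powerset, Finset.mem_Icc]
    exact ⟨fun ⟨hS, hT⟩ => ⟨⟨hT, hS⟩, hT.trans hS⟩, fun ⟨⟨hT, hS⟩, _⟩ => ⟨hS, hT⟩⟩
  have hinner : ∀ T ∈ U.powerset,
      ∑ S ∈ Finset.Icc T U, (-1 : ℝ) ^ (S.card - T.card) * h T = if T = U then h U else 0 := by
    intro T hT
    rw [Finset.mem_powerset] at hT
    have hshift : ∑ S ∈ Finset.Icc T U, (-1 : ℝ) ^ (S.card - T.card) =
        ∑ W ∈ (U \ T).powerset, (-1 : ℝ) ^ W.card := by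
      refine Finset.sum_bij' (fun S _ => S \ T) (fun W _ => T ∪ W) ?_ ?_ ?_ ?_ ?_
      · intro S hS
        rw [Finset.mem_Icc] at hS
        exact Finset.mem_powerset.2 (Finset.sdiff_subset_sdiff hS.2 le_rfl)
      · intro W hW
        rw [Finset.mem_powerset] at hW
        exact Finset.mem_Icc.2 ⟨Finset.subset_union_left,
          Finset.union_subset hT (hW.trans Finset.sdiff_subset)⟩
      · intro S hS
        exact Finset.union_sdiff_of_subset (Finset.mem_Icc.1 hS).1
      · intro W hW
        rw [Finset.mem_powerset] at hW
        exact Finset.union_sdiff_cancel_left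
          (Finset.disjoint_sdiff.mono_right hW)
      · intro S hS
        rw [Finset.card_sdiff_of_subset (Finset.mem_Icc.1 hS).1]
    have hsign : ∑ W ∈ (U \ T).powerset, (-1 : ℝ) ^ W.card = if U \ T = ∅ then 1 else 0 := by
      exact_mod_cast Finset.sum_powerset_neg_one_pow_card (x := U \ T)
    rw [← Finset.sum_mul, hshift, hsign]
    by_cases hTU : T = U
    · simp [hTU]
    · have : ¬ U \ T = ∅ := fun h0 => hTU (hT.antisymm (Finset.sdiff_eq_empty_iff_subset.1 h0))
      simp [hTU, this]
  rw [hswap, Finset.sum_congr rfl hinner]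
  simp

theorem HS_empty {𝒳 : Type*} [Fintype 𝒳] [DecidableEq 𝒳] {k : ℕ}
    (P : (Fin k → 𝒳) → ℝ) (hP1 : ∑ y, P y = 1) : HS P ∅ = 0 := by
  have hmarg : ∀ z, margS P ∅ z = 1 := fun z => by simp [margS, hP1]
  simp [HS, entropy, hmarg]

theorem HS_univ {𝒳 : Type*} [Fintype 𝒳] [DecidableEq 𝒳] {k : ℕ}
    (P : (Fin k → 𝒳) → ℝ) : HS P Finset.univ = entropy P := by
  let e : ((i : (Finset.univ : Finset (Fin k))) → 𝒳) ≃ (Fin k → 𝒳) :=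
    { toFun := fun z i => z ⟨i, Finset.mem_univ i⟩
      invFun := fun y i => y i
      left_inv := fun _ => rfl
      right_inv := fun _ => rfl }
  have hmarg : ∀ z, margS P Finset.univ z = P (e z) := by
    intro z
    have hiff : ∀ y : Fin k → 𝒳,
        (∀ i : (Finset.univ : Finset (Fin k)), y i = z i) ↔ y = e z := fun y =>
      ⟨fun h => funext fun i => h ⟨i, Finset.mem_univ i⟩, fun h i => by rw [h]; rfl⟩
    simp only [margS, hiff, Finset.sum_ite_eq', Finset.mem_univ, if_true]
  simp only [HS, entropy, hmarg]
  rw [e.sum_comp fun y => P y * Real.logb 2 (P y)]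

theorem II_empty {𝒳 : Type*} [Fintype 𝒳] [DecidableEq 𝒳] {k : ℕ}
    (P : (Fin k → 𝒳) → ℝ) : II P ∅ = -HS P ∅ := by
  simp [II]

theorem II_singleton {𝒳 : Type*} [Fintype 𝒳] [DecidableEq 𝒳] {k : ℕ}
    (P : (Fin k → 𝒳) → ℝ) (i : Fin k) : II P {i} = HS P ∅ - HS P {i} := by
  have hne : (∅ : Finset (Fin k)) ≠ {i} := (Finset.singleton_ne_empty i).symm
  have hpow : ({i} : Finset (Fin k)).powerset = {∅, {i}} := by
    ext T
    simp [Finset.subset_singleton_iff]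
  rw [II, hpow, Finset.sum_pair hne]
  simp only [Finset.card_singleton, Finset.card_empty]
  norm_num
  ring

theorem sum_range_Ir {𝒳 : Type*} [Fintype 𝒳] [DecidableEq 𝒳] {k : ℕ}
    (P : (Fin k → 𝒳) → ℝ) : ∑ r ∈ Finset.range (k + 1), Ir P r = -HS P Finset.univ := by
  have hsplit := Finset.sum_powerset (Finset.univ : Finset (Fin k)) (II P)
  rw [Finset.card_univ, Fintype.card_fin] at hsplit
  simp only [Ir]
  rw [← hsplit]
  simp only [II, Finset.sum_neg_distrib]
  rw [sum_powerset_sum_powerset_neg_one_pow]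

theorem sum_interactions_eq_total_correlation
    {𝒳 : Type*} [Fintype 𝒳] [DecidableEq 𝒳] [Nonempty 𝒳] {k : ℕ} (hk : 1 ≤ k)
    (P : (Fin k → 𝒳) → ℝ) (hP0 : ∀ y, 0 ≤ P y) (hP1 : ∑ y, P y = 1) :
    ∑ r ∈ Finset.Icc 2 k, Ir P r = (∑ i, HS P {i}) - entropy P := by
  have hzero : Ir P 0 = 0 := by
    simp [Ir, II_empty, HS_empty P hP1]
  have hone : Ir P 1 = -∑ i, HS P {i} := by
    simp [Ir, Finset.powersetCard_one, II_singleton, HS_empty P hP1]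
  have htotal := sum_range_Ir P
  rw [Finset.range_eq_Ico, Finset.sum_eq_sum_Ico_succ_bot (by omega),
    Finset.sum_eq_sum_Ico_succ_bot (by omega), hzero, hone, HS_univ] at htotal
  have hIcc : Finset.Icc 2 k = Finset.Ico (0 + 1 + 1) (k + 1) := by
    ext r
    simp only [Finset.mem_Icc, Finset.mem_Ico]
    omega
  rw [hIcc]
  linarith
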